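/- Let R be a commutative ring, X a type, and π a biderivation on FreeAlgebra R X. Let J be the two-sided ideal generated by the elements ι(x)·ι(y) − ι(y)·ι(x) − π(ι(x), ι(y)) for x, y ∈ X, let U := (FreeAlgebra R X)/J, and let q : FreeAlgebra R X → U be the quotient algebra map. Then for all f, g ∈ FreeAlgebra R X one has q(π(f,g)) = q(f)·q(g) − q(g)·q(f); that is, π descends to the canonical Poisson structure π_c(a,b) := ab − ba on U. -/

import Mathlib

/-- A biderivation on an associative unital `R`-algebra `A`: an `R`-bilinear map
`π : A → A → A` such that `π (a*b) c = a * π b c + π a c * b` and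
`π a (b*c) = b * π a c + π a b * c`. -/
def IsBiderivation {R A : Type*} [CommRing R] [Ring A] [Algebra R A]
    (π : A →ₗ[R] A →ₗ[R] A) : Prop :=
  (∀ a b c : A, π (a * b) c = a * π b c + π a c * b) ∧
  (∀ a b c : A, π a (b * c) = b * π a c + π a b * c)

/-- The relation on `FreeAlgebra R X` whose associated quotient (`RingQuot`) is the
quotient by the two-sided ideal `J` generated by the elements
`ι x * ι y − ι y * ι x − π (ι x) (ι y)` for `x y : X`. -/
def genCommRel {R : Type*} [CommRing R] {X : Type*}
    (π : FreeAlgebra R X →ₗ[R] FreeAlgebra R X →ₗ[R] FreeAlgebra R X) :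
    FreeAlgebra R X → FreeAlgebra R X → Prop := fun a b =>
  ∃ x y : X, a = FreeAlgebra.ι R x * FreeAlgebra.ι R y ∧
    b = FreeAlgebra.ι R y * FreeAlgebra.ι R x + π (FreeAlgebra.ι R x) (FreeAlgebra.ι R y)

namespace IsBiderivation

variable {R A : Type*} [CommRing R] [Ring A] [Algebra R A] {π : A →ₗ[R] A →ₗ[R] A}

theorem map_algebraMap_left (hπ : IsBiderivation π) (r : R) (c : A) :
    π (algebraMap R A r) c = 0 := by
  have h : π 1 c = 0 := by simpa using hπ.1 1 1 c
  simp [Algebra.algebraMap_eq_smul_one, h]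

theorem map_algebraMap_right (hπ : IsBiderivation π) (a : A) (r : R) :
    π a (algebraMap R A r) = 0 := by
  have h : π a 1 = 0 := by simpa using hπ.2 a 1 1
  simp [Algebra.algebraMap_eq_smul_one, h]

end IsBiderivation

/-- An algebra map out of a free algebra that sends a biderivation to the commutator on
generators does so everywhere. -/
theorem IsBiderivation.map_eq_commutator_of_generators {R X B : Type*} [CommRing R]
    [Ring B] [Algebra R B]
    {π : FreeAlgebra R X →ₗ[R] FreeAlgebra R X →ₗ[R] FreeAlgebra R X}
    (hπ : IsBiderivation π) (q : FreeAlgebra R X →ₐ[R] B)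
    (hq : ∀ x y : X, q (π (FreeAlgebra.ι R x) (FreeAlgebra.ι R y)) =
      q (FreeAlgebra.ι R x) * q (FreeAlgebra.ι R y) -
        q (FreeAlgebra.ι R y) * q (FreeAlgebra.ι R x))
    (f g : FreeAlgebra R X) : q (π f g) = q f * q g - q g * q f := by
  induction f using FreeAlgebra.induction with
  | grade0 r =>
    rw [hπ.map_algebraMap_left, map_zero, AlgHom.commutes, Algebra.commutes, sub_self]
  | grade1 x =>
    induction g using FreeAlgebra.induction with
    | grade0 r =>
      rw [hπ.map_algebraMap_right, map_zero, AlgHom.commutes, Algebra.commutes, sub_self]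
    | grade1 y => exact hq x y
    | mul a b ha hb =>
      simp only [hπ.2, map_add, map_mul, ha, hb]
      noncomm_ring
    | add a b ha hb =>
      simp only [map_add, ha, hb]
      noncomm_ring
  | mul a b ha hb =>
    simp only [hπ.1, map_add, map_mul, ha, hb]
    noncomm_ring
  | add a b ha hb =>
    simp only [map_add, LinearMap.add_apply, ha, hb]
    noncomm_ring

/-- Let `π` be a biderivation on `FreeAlgebra R X`, `J` the two-sided ideal
generated by `ι x * ι y − ι y * ι x − π (ι x) (ι y)` (`x y : X`),
`U := (FreeAlgebra R X)/J` and `q` the quotient algebra map.  Then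
`q (π f g) = q f * q g − q g * q f` for all `f g`; that is, `π` descends to the
canonical Poisson structure `π_c(a,b) = ab − ba` on `U`. -/
theorem biderivation_descends_to_canonical_Poisson_structure
    (R : Type*) [CommRing R] (X : Type*)
    (π : FreeAlgebra R X →ₗ[R] FreeAlgebra R X →ₗ[R] FreeAlgebra R X)
    (hπ : IsBiderivation π) :
    ∀ f g : FreeAlgebra R X,
      RingQuot.mkAlgHom R (genCommRel π) (π f g) =
        RingQuot.mkAlgHom R (genCommRel π) f * RingQuot.mkAlgHom R (genCommRel π) g -
        RingQuot.mkAlgHom R (genCommRel π) g * RingQuot.mkAlgHom R (genCommRel π) f := by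
  refine hπ.map_eq_commutator_of_generators _ fun x y => ?_
  have h := RingQuot.mkAlgHom_rel R (s := genCommRel π) ⟨x, y, rfl, rfl⟩
  rw [map_mul, map_add, map_mul] at h
  rw [h, add_sub_cancel_left]
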